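/- Let M > 0 and let Ψ satisfy (Ψ1)–(Ψ3). Then h_M := inf_{R_M} H_r < 0. More precisely, for any fixed bounded, compactly supported nonzero ρ ∈ R_M and the rescalings ρ̄_b(x) := b³ ρ(bx) ∈ R_M (b > 0), one has H_r(ρ̄_b) = b^{-3}∫Ψ(b³ρ) dx + b E_pot(ρ) ≤ C b^{3/n'} + b E_pot(ρ) < 0 for all sufficiently small b > 0. -/

import Mathlib

open MeasureTheory Filter Topology Set ENNReal

noncomputable section

/-- Physical space `ℝ³`. -/
abbrev R3 : Type := EuclideanSpace ℝ (Fin 3)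

/-- Spatial density `ρ_f(x) = ∫ f(x,v) dv` induced by a phase-space density. -/
def spatialDensity (f : R3 × R3 → ℝ) (x : R3) : ℝ := ∫ v, f (x, v)

/-- Kinetic energy `E_kin(f) = (1/2)∫∫ |v|² f dv dx`. -/
def Ekin (f : R3 × R3 → ℝ) : ℝ := (1/2) * ∫ p : R3 × R3, ‖p.2‖ ^ 2 * f p

/-- `D(σ) = ∫∫ σ(x)σ(y)/|x-y| dx dy`. -/
def Dpair (σ : R3 → ℝ) : ℝ := ∫ x, ∫ y, σ x * σ y / ‖x - y‖

/-- Potential energy `E_pot(ρ) = -(1/2)∫∫ ρ(x)ρ(y)/|x-y| dx dy`. -/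
def Epot (ρ : R3 → ℝ) : ℝ := -(1/2) * Dpair ρ

/-- Casimir functional `C(f) = ∫∫ Φ(f) dv dx`. -/
def Casimir (Φ : ℝ → ℝ) (f : R3 × R3 → ℝ) : ℝ := ∫ p, Φ (f p)

/-- Energy-Casimir functional `H_C = E_kin + E_pot + C`. -/
def HC (Φ : ℝ → ℝ) (f : R3 × R3 → ℝ) : ℝ :=
  Ekin f + Epot (spatialDensity f) + Casimir Φ f

/-- Membership in the constraint set `F_M`. -/
structure MemFM (Φ : ℝ → ℝ) (M : ℝ) (f : R3 × R3 → ℝ) : Prop where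
  nonneg : ∀ p, 0 ≤ f p
  integrable : Integrable f
  mass : (∫ p, f p) = M
  kin_int : Integrable (fun p : R3 × R3 => ‖p.2‖ ^ 2 * f p)
  cas_int : Integrable (fun p => Φ (f p))

/-- The constraint set `F_M`. -/
def FMset (Φ : ℝ → ℝ) (M : ℝ) : Set ((R3 × R3) → ℝ) := {f | MemFM Φ M f}

/-- Hypotheses (Φ1)-(Φ3) on the Casimir function `Φ`, with derivative `Φ'`
and growth exponents `k`, `k'`. -/
structure IsPhi (Φ Φ' : ℝ → ℝ) (k k' : ℝ) : Prop where
  zero : Φ 0 = 0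
  deriv_zero : Φ' 0 = 0
  hasDeriv : ∀ s ∈ Ici (0:ℝ), HasDerivAt Φ (Φ' s) s
  derivCont : ContinuousOn Φ' (Ici 0)
  nonneg : ∀ s ∈ Ici (0:ℝ), 0 ≤ Φ s
  sconvex : StrictConvexOn ℝ (Ici 0) Φ
  k_pos : 0 < k
  k_lt : k < 3/2
  k'_pos : 0 < k'
  k'_lt : k' < 3/2
  growth_large : ∃ C > 0, ∃ F₁ > 0, ∀ s, F₁ ≤ s → C * s ^ (1 + 1/k) ≤ Φ s
  growth_small : ∃ C > 0, ∃ F₂ > 0, ∀ s, 0 ≤ s → s ≤ F₂ → Φ s ≤ C * s ^ (1 + 1/k')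

/-- Potential `U_ρ(x) = -∫ ρ(y)/|x-y| dy` induced by a spatial density. -/
def U0rho (ρ : R3 → ℝ) (x : R3) : ℝ := -∫ y, ρ y / ‖x - y‖

/-- Particle energy `E(x,v) = (1/2)|v|² + U₀(x)` for the state `f₀`. -/
def Epart (f₀ : R3 × R3 → ℝ) (p : R3 × R3) : ℝ :=
  (1/2) * ‖p.2‖ ^ 2 + U0rho (spatialDensity f₀) p.1

/-- Reduced density function `Ψ(s)`, obtained from `Φ` by minimizing the sum of kinetic
energy density and Casimir density over all velocity profiles of total mass `s`. -/
def PsiOf (Φ : ℝ → ℝ) (s : ℝ) : ℝ :=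
  sInf { r : ℝ | ∃ g : R3 → ℝ, (∀ v, 0 ≤ g v) ∧ Integrable g ∧ (∫ v, g v) = s ∧
    Integrable (fun v => (1/2) * ‖v‖ ^ 2 * g v + Φ (g v)) ∧
    r = ∫ v, ((1/2) * ‖v‖ ^ 2 * g v + Φ (g v)) }

/-- Reduced functional `H_r(ρ) = ∫ Ψ(ρ) dx + E_pot(ρ)`. -/
def Hr (Ψ : ℝ → ℝ) (ρ : R3 → ℝ) : ℝ := (∫ x, Ψ (ρ x)) + Epot ρ

/-- Membership in the reduced constraint set `R_M`. -/
structure MemRM (Ψ : ℝ → ℝ) (M : ℝ) (ρ : R3 → ℝ) : Prop where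
  nonneg : ∀ x, 0 ≤ ρ x
  integrable : Integrable ρ
  mass : (∫ x, ρ x) = M
  psi_int : Integrable (fun x => Ψ (ρ x))

/-- The reduced constraint set `R_M`. -/
def RMset (Ψ : ℝ → ℝ) (M : ℝ) : Set (R3 → ℝ) := {ρ | MemRM Ψ M ρ}

/-- Hypotheses (Ψ1)-(Ψ3) on `Ψ`, with derivative `Ψ'` and growth exponents `n`, `n'`. -/
structure IsPsi (Ψ Ψ' : ℝ → ℝ) (n n' : ℝ) : Prop where
  zero : Ψ 0 = 0
  deriv_zero : Ψ' 0 = 0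
  hasDeriv : ∀ s ∈ Ici (0:ℝ), HasDerivAt Ψ (Ψ' s) s
  derivCont : ContinuousOn Ψ' (Ici 0)
  nonneg : ∀ s ∈ Ici (0:ℝ), 0 ≤ Ψ s
  sconvex : StrictConvexOn ℝ (Ici 0) Ψ
  n_pos : 0 < n
  n_lt : n < 3
  n'_pos : 0 < n'
  n'_lt : n' < 3
  growth_large : ∃ C > 0, ∃ s₁ > 0, ∀ s, s₁ ≤ s → C * s ^ (1 + 1/n) ≤ Ψ s
  growth_small : ∃ C > 0, ∃ s₂ > 0, ∀ s, 0 ≤ s → s ≤ s₂ → Ψ s ≤ C * s ^ (1 + 1/n')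

/-- Relative "distance" `d(f,f₀) = ∫∫ [Φ(f) - Φ(f₀) + E (f - f₀)] dv dx`. -/
def dVP (Φ : ℝ → ℝ) (f₀ f : R3 × R3 → ℝ) : ℝ :=
  ∫ p, (Φ (f p) - Φ (f₀ p) + Epart f₀ p * (f p - f₀ p))

def kerR (R : ℝ) (x : R3) : ℝ := if ‖x‖ < R then 1 / ‖x‖ else 0

lemma kerR_nonneg (R : ℝ) (x : R3) : 0 ≤ kerR R x := by
  unfold kerR; split_ifs <;> positivity

lemma kerR_one_integrable : Integrable (kerR 1) := by
  have h := (integrable_fun_norm_addHaar (μ := (volume : Measure R3))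
    (f := fun r : ℝ => if r < 1 then 1 / r else 0)).2 ?_
  · exact h
  · have h1 : IntegrableOn (fun y : ℝ => y) (Ioo 0 1) :=
      (continuous_id.integrableOn_Icc (a := (0:ℝ)) (b := 1)).mono_set Ioo_subset_Icc_self
    have h2 : IntegrableOn (fun y : ℝ => (Ioo (0:ℝ) 1).indicator (fun y => y) y) (Ioi 0) :=
      ((integrable_indicator_iff measurableSet_Ioo).2 h1).integrableOn
    refine h2.congr_fun ?_ measurableSet_Ioi
    intro y hy
    have hy0 : (0:ℝ) < y := hy
    simp only [indicator, mem_Ioo, hy0, true_and, finrank_euclideanSpace_fin, smul_eq_mul]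
    split_ifs
    · field_simp
    · simp

lemma kerR_scale {R : ℝ} (hR : 0 < R) (x : R3) : kerR R x = R⁻¹ * kerR 1 (R⁻¹ • x) := by
  unfold kerR
  have h : ‖R⁻¹ • x‖ = R⁻¹ * ‖x‖ := by rw [norm_smul, Real.norm_of_nonneg (by positivity)]
  rw [h]
  have h2 : (R⁻¹ * ‖x‖ < 1) ↔ ‖x‖ < R := by
    rw [inv_mul_lt_iff₀ hR, mul_one]
  simp only [h2]
  split_ifs
  · by_cases hx : ‖x‖ = 0
    · simp [hx]
    · field_simp
  · simp

def kc : ℝ := ∫ x : R3, kerR 1 x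

lemma kc_nonneg : 0 ≤ kc := integral_nonneg (kerR_nonneg 1)

lemma kerR_integrable {R : ℝ} (hR : 0 < R) : Integrable (kerR R) := by
  have : kerR R = fun x => R⁻¹ * kerR 1 (R⁻¹ • x) := funext (kerR_scale hR)
  rw [this]
  exact ((integrable_comp_smul_iff volume _ (by positivity)).2 kerR_one_integrable).const_mul _

lemma kerR_lintegral {R : ℝ} (hR : 0 < R) (x : R3) :
    ∫⁻ y, ENNReal.ofReal (kerR R (x - y)) = ENNReal.ofReal (R ^ 2 * kc) := by
  rw [lintegral_sub_left_eq_self (fun z => ENNReal.ofReal (kerR R z)) x,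
    ← ofReal_integral_eq_lintegral_ofReal (kerR_integrable hR) (ae_of_all _ (kerR_nonneg R))]
  congr 1
  simp_rw [kerR_scale hR]
  rw [integral_const_mul, Measure.integral_comp_smul]
  simp only [finrank_euclideanSpace_fin, smul_eq_mul, kc]
  rw [abs_of_pos (by positivity)]
  field_simp

lemma ker_le {R : ℝ} (hR : 0 < R) (z : R3) : 1 / ‖z‖ ≤ kerR R z + R⁻¹ := by
  unfold kerR
  split_ifs with h
  · have : 0 < R⁻¹ := by positivity
    linarith
  · push Not at h
    rw [zero_add, ← one_div]
    exact one_div_le_one_div_of_le hR h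

/-- inner bathtub bound -/
lemma inner_bound (g : R3 → ℝ) (hgm : Measurable g) (hg : ∀ x, 0 ≤ g x) {R s : ℝ} (hR : 0 < R)
    (x : R3) (S : Set R3) (hS : ∀ y ∈ S, g y ≤ s) (hSm : MeasurableSet S) (hs : 0 ≤ s) :
    ∫⁻ y in S, ENNReal.ofReal (g y * (1 / ‖x - y‖)) ≤
      ENNReal.ofReal (s * (R ^ 2 * kc)) + ENNReal.ofReal R⁻¹ * ∫⁻ y, ENNReal.ofReal (g y) := by
  calc ∫⁻ y in S, ENNReal.ofReal (g y * (1 / ‖x - y‖))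
      ≤ ∫⁻ y in S, (ENNReal.ofReal s * ENNReal.ofReal (kerR R (x - y)) +
          ENNReal.ofReal R⁻¹ * ENNReal.ofReal (g y)) := by
        refine setLIntegral_mono' hSm ?_
        intro y hy
        have hk := kerR_nonneg R (x - y)
        have hRi : 0 ≤ R⁻¹ := by positivity
        rw [← ENNReal.ofReal_mul hs, ← ENNReal.ofReal_mul hRi,
          ← ENNReal.ofReal_add (mul_nonneg hs hk) (mul_nonneg hRi (hg y))]
        apply ENNReal.ofReal_le_ofReal
        have h1 := mul_le_mul_of_nonneg_left (ker_le hR (x - y)) (hg y)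
        have h2 := mul_le_mul_of_nonneg_right (hS y hy) hk
        linarith
    _ ≤ ∫⁻ y, (ENNReal.ofReal s * ENNReal.ofReal (kerR R (x - y)) +
          ENNReal.ofReal R⁻¹ * ENNReal.ofReal (g y)) := setLIntegral_le_lintegral _ _
    _ = _ := by
        rw [lintegral_add_right _ (by fun_prop), lintegral_const_mul' _ _ ENNReal.ofReal_ne_top,
          lintegral_const_mul' _ _ ENNReal.ofReal_ne_top, kerR_lintegral hR,
          ← ENNReal.ofReal_mul hs]

/-- the key estimate for measurable nonnegative functions -/
lemma key_meas (g : R3 → ℝ) (hgm : Measurable g) (hg : ∀ x, 0 ≤ g x) (M : ℝ) (hM : 0 ≤ M)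
    (hmass : ∫⁻ y, ENNReal.ofReal (g y) = ENNReal.ofReal M) :
    ∫⁻ x, ∫⁻ y, ENNReal.ofReal (g x * g y / ‖x - y‖) ≤
      2 * ∫⁻ x, ENNReal.ofReal ((kc + M) * g x ^ (4/3 : ℝ)) := by
  set F : R3 → R3 → ℝ≥0∞ := fun x y => ENNReal.ofReal (g x * g y / ‖x - y‖) with hF
  have hFm : Measurable (Function.uncurry F) := by
    unfold Function.uncurry
    simp only [hF]
    fun_prop
  have hFs : ∀ x y, F x y = F y x := by
    intro x y; simp only [hF]; rw [mul_comm, norm_sub_rev]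
  set S : Set (R3 × R3) := {p | g p.2 ≤ g p.1} with hSdef
  have hSm : MeasurableSet S :=
    measurableSet_le (hgm.comp measurable_snd) (hgm.comp measurable_fst)
  set G : R3 → R3 → ℝ≥0∞ := fun x y => S.indicator (Function.uncurry F) (x, y) with hG
  have hGm : Measurable (Function.uncurry G) := hFm.indicator hSm
  have hle : ∀ x y, F x y ≤ G x y + G y x := by
    intro x y
    rcases le_total (g y) (g x) with h | h
    · have : G x y = F x y := by simp [hG, hSdef, h, Function.uncurry]
      rw [this]; exact le_self_add
    · have : G y x = F x y := by simp [hG, hSdef, h, Function.uncurry, hFs y x]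
      rw [this]; exact le_add_self
  have hGm1 : ∀ x, Measurable (G x) := fun x => hGm.comp measurable_prodMk_left
  have hGm2 : Measurable fun x => ∫⁻ y, G x y := hGm.lintegral_prod_right'
  calc ∫⁻ x, ∫⁻ y, F x y ≤ ∫⁻ x, ∫⁻ y, (G x y + G y x) :=
        lintegral_mono fun x => lintegral_mono fun y => hle x y
    _ = ∫⁻ x, ((∫⁻ y, G x y) + ∫⁻ y, G y x) := by
        congr 1; ext x; exact lintegral_add_left (hGm1 x) _
    _ = (∫⁻ x, ∫⁻ y, G x y) + ∫⁻ x, ∫⁻ y, G y x := lintegral_add_left hGm2 _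
    _ = 2 * ∫⁻ x, ∫⁻ y, G x y := by
        rw [two_mul]; congr 1
        rw [lintegral_lintegral_swap (f := fun x y => G y x)]
        exact (hGm.comp measurable_swap).aemeasurable
    _ ≤ _ := by
        gcongr with x
        rcases (hg x).eq_or_lt with h0 | hpos
        · have : ∀ y, G x y = 0 := by
            intro y
            have : F x y = 0 := by simp [hF, ← h0]
            simp only [hG, indicator, Function.uncurry]; split_ifs <;> simp [this]
          simp [this]
        · set s := g x with hs
          have hR : 0 < s ^ (-(1/3) : ℝ) := by positivity
          have hTm : MeasurableSet {y | g y ≤ s} := measurableSet_le hgm measurable_const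
          have e : ∀ y, G x y =
              {y | g y ≤ s}.indicator (fun y => ENNReal.ofReal s * ENNReal.ofReal (g y * (1 / ‖x - y‖))) y := by
            intro y
            simp only [hG, indicator, hSdef, mem_ofPred_eq, ← hs]
            split_ifs
            · simp only [Function.uncurry, hF]
              rw [← ENNReal.ofReal_mul hpos.le, ← hs]; congr 1; ring
            · rfl
          simp_rw [e]
          rw [lintegral_indicator hTm, lintegral_const_mul' _ _ ENNReal.ofReal_ne_top]
          refine (mul_le_mul_right (inner_bound g hgm hg hR x {y | g y ≤ s} (fun y hy => hy) hTm hpos.le) _).trans ?_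
          have hRi : 0 ≤ (s ^ (-(1/3) : ℝ))⁻¹ := by positivity
          rw [hmass, ← ENNReal.ofReal_mul hRi, ← ENNReal.ofReal_add _ (by positivity),
            ← ENNReal.ofReal_mul hpos.le]
          · apply ENNReal.ofReal_le_ofReal
            apply le_of_eq
            rw [← Real.rpow_neg hpos.le, ← Real.rpow_natCast, ← Real.rpow_mul hpos.le]
            have h1 : s * (s * (s ^ (-(1/3) * ((2:ℕ):ℝ) : ℝ))) = s ^ (4/3 : ℝ) := by
              nth_rewrite 1 [← Real.rpow_one s]
              nth_rewrite 2 [← Real.rpow_one s]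
              rw [← Real.rpow_add hpos, ← Real.rpow_add hpos]; norm_num
            have h2 : s * s ^ (- -(1/3) : ℝ) = s ^ (4/3 : ℝ) := by
              nth_rewrite 1 [← Real.rpow_one s]
              rw [← Real.rpow_add hpos]; norm_num
            linear_combination kc * h1 + M * h2
          · have := kc_nonneg; positivity

/-- Upper bound of the pair energy by the `L^{4/3}` integral. -/
lemma Dpair_bound (ρ : R3 → ℝ) (hρ : ∀ x, 0 ≤ ρ x) (hInteg : Integrable ρ) (M : ℝ) (hM : 0 ≤ M)
    (hmass : (∫ x, ρ x) = M) :
    ENNReal.ofReal (Dpair ρ) ≤ 2 * ∫⁻ x, ENNReal.ofReal ((kc + M) * ρ x ^ (4/3 : ℝ)) := by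
  obtain ⟨g₀, hg₀m, hg₀⟩ := hInteg.aemeasurable
  set g : R3 → ℝ := fun x => max (g₀ x) 0 with hg
  have hgm : Measurable g := hg₀m.max measurable_const
  have hgn : ∀ x, 0 ≤ g x := fun x => le_max_right _ _
  have hae : ρ =ᵐ[volume] g := by
    filter_upwards [hg₀] with x hx
    simp only [hg, ← hx]; exact (max_eq_left (hρ x)).symm
  have hm : ∫⁻ y, ENNReal.ofReal (g y) = ENNReal.ofReal M := by
    rw [← hmass, ofReal_integral_eq_lintegral_ofReal hInteg (ae_of_all _ hρ)]
    exact lintegral_congr_ae (by filter_upwards [hae] with x hx; rw [hx])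
  have h := key_meas g hgm hgn M hM hm
  have h1 : ∫⁻ x, ENNReal.ofReal ((kc + M) * g x ^ (4/3 : ℝ)) =
      ∫⁻ x, ENNReal.ofReal ((kc + M) * ρ x ^ (4/3 : ℝ)) :=
    lintegral_congr_ae (by filter_upwards [hae] with x hx; rw [hx])
  rw [h1] at h
  refine le_trans ?_ h
  have h2 : Dpair ρ = ∫ x, ∫ y, g x * g y / ‖x - y‖ := by
    unfold Dpair
    refine integral_congr_ae ?_
    filter_upwards [hae] with x hx
    refine integral_congr_ae ?_
    filter_upwards [hae] with y hy
    rw [hx, hy]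
  rw [h2]
  calc ENNReal.ofReal (∫ x, ∫ y, g x * g y / ‖x - y‖)
      ≤ ‖∫ x, ∫ y, g x * g y / ‖x - y‖‖ₑ := Real.ofReal_le_enorm _
    _ ≤ ∫⁻ x, ‖∫ y, g x * g y / ‖x - y‖‖ₑ := enorm_integral_le_lintegral_enorm _
    _ ≤ ∫⁻ x, ∫⁻ y, ‖g x * g y / ‖x - y‖‖ₑ :=
        lintegral_mono fun x => enorm_integral_le_lintegral_enorm _
    _ = _ := by
        congr 1; ext x; congr 1; ext y
        exact Real.enorm_of_nonneg (div_nonneg (mul_nonneg (hgn x) (hgn y)) (norm_nonneg _))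

/-- Superlinear growth absorbs the power `4/3`. -/
lemma psi_absorb (Ψ Ψ' : ℝ → ℝ) (n n' : ℝ) (hΨ : IsPsi Ψ Ψ' n n') (A : ℝ) (hA : 0 ≤ A) :
    ∃ K, 0 ≤ K ∧ ∀ s, 0 ≤ s → A * s ^ (4/3 : ℝ) ≤ Ψ s + K * s := by
  obtain ⟨C, hC, s₁, hs₁, hgr⟩ := hΨ.growth_large
  have hn := hΨ.n_pos
  have hn3 := hΨ.n_lt
  have he : 0 < 1 / n - 1 / 3 := by
    have := one_div_lt_one_div_of_lt hn hn3
    linarith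
  have ht := tendsto_rpow_atTop he
  obtain ⟨T, hT⟩ := (ht.eventually_ge_atTop (A / C)).exists_forall_of_atTop
  set T' := max T s₁ with hT'
  have hTpos : 0 < T' := lt_of_lt_of_le hs₁ (le_max_right _ _)
  refine ⟨A * T' ^ (1/3 : ℝ), by positivity, ?_⟩
  intro s hs
  rcases hs.eq_or_lt with h0 | hpos
  · rw [← h0, hΨ.zero, Real.zero_rpow (by norm_num)]; simp
  have h43 : s ^ (4/3 : ℝ) = s * s ^ (1/3 : ℝ) := by
    nth_rewrite 2 [← Real.rpow_one s]
    rw [← Real.rpow_add hpos]; norm_num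
  rcases le_total s T' with h | h
  · have h1 := hΨ.nonneg s hs
    have h2 : s ^ (1/3 : ℝ) ≤ T' ^ (1/3 : ℝ) := Real.rpow_le_rpow hs h (by norm_num)
    rw [h43]
    have h3 := mul_le_mul_of_nonneg_left h2 (mul_nonneg hA hs)
    linarith
  · have h1 := hgr s ((le_max_right _ _).trans h)
    have h2 := hT s ((le_max_left _ _).trans h)
    have h3 : s ^ (1 + 1/n) = s ^ (4/3 : ℝ) * s ^ (1 / n - 1 / 3) := by
      rw [← Real.rpow_add hpos]; congr 1; ring
    have h4 : A ≤ C * s ^ (1 / n - 1 / 3) := by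
      rw [div_le_iff₀ hC] at h2; linarith
    have h5 : 0 ≤ s ^ (4/3 : ℝ) := by positivity
    have h6 := mul_le_mul_of_nonneg_right h4 h5
    have h7 : 0 ≤ A * T' ^ (1/3 : ℝ) * s := by positivity
    rw [h3] at h1
    linarith

lemma Hr_bddBelow (Ψ Ψ' : ℝ → ℝ) (n n' : ℝ) (hΨ : IsPsi Ψ Ψ' n n') (M : ℝ) (hM : 0 < M) :
    BddBelow (Hr Ψ '' RMset Ψ M) := by
  have hA : 0 ≤ kc + M := by have := kc_nonneg; linarith
  obtain ⟨K, hK, hab⟩ := psi_absorb Ψ Ψ' n n' hΨ (kc + M) hA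
  refine ⟨-(K * M), ?_⟩
  rintro _ ⟨ρ, hρ, rfl⟩
  have hρ' : MemRM Ψ M ρ := hρ
  have hb := Dpair_bound ρ hρ'.nonneg hρ'.integrable M hM.le hρ'.mass
  have hI : Integrable (fun x => Ψ (ρ x) + K * ρ x) :=
    hρ'.psi_int.add (hρ'.integrable.const_mul K)
  have hnn : ∀ x, 0 ≤ Ψ (ρ x) + K * ρ x := fun x =>
    add_nonneg (hΨ.nonneg _ (hρ'.nonneg x)) (mul_nonneg hK (hρ'.nonneg x))
  have h1 : ∫⁻ x, ENNReal.ofReal ((kc + M) * ρ x ^ (4/3 : ℝ)) ≤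
      ENNReal.ofReal (∫ x, (Ψ (ρ x) + K * ρ x)) := by
    rw [ofReal_integral_eq_lintegral_ofReal hI (ae_of_all _ hnn)]
    exact lintegral_mono fun x => ENNReal.ofReal_le_ofReal (hab _ (hρ'.nonneg x))
  have h2 : (∫ x, (Ψ (ρ x) + K * ρ x)) = (∫ x, Ψ (ρ x)) + K * M := by
    rw [integral_add hρ'.psi_int (hρ'.integrable.const_mul K), integral_const_mul, hρ'.mass]
  have h3 : ENNReal.ofReal (Dpair ρ) ≤ ENNReal.ofReal (2 * ((∫ x, Ψ (ρ x)) + K * M)) := by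
    rw [ENNReal.ofReal_mul (by norm_num), ← h2]
    refine hb.trans ?_
    rw [ENNReal.ofReal_ofNat]
    gcongr
  have h4 : 0 ≤ 2 * ((∫ x, Ψ (ρ x)) + K * M) := by
    rw [← h2]; exact mul_nonneg (by norm_num) (integral_nonneg hnn)
  have h5 := (ENNReal.ofReal_le_ofReal_iff h4).1 h3
  unfold Hr Epot
  linarith

/-- Scaling of the pair energy. -/
lemma Dpair_scale (ρ : R3 → ℝ) (b : ℝ) (hb : 0 < b) :
    Dpair (fun x => b ^ 3 * ρ (b • x)) = b * Dpair ρ := by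
  have hpt : ∀ x y : R3, b ^ 3 * ρ (b • x) * (b ^ 3 * ρ (b • y)) / ‖x - y‖ =
      b ^ 7 * (ρ (b • x) * ρ (b • y) / ‖b • x - b • y‖) := by
    intro x y
    rw [← smul_sub, norm_smul, Real.norm_of_nonneg hb.le]
    by_cases h : ‖x - y‖ = 0
    · simp [h]
    · field_simp
  unfold Dpair
  simp_rw [hpt, integral_const_mul]
  have h1 : ∀ x : R3, ∫ y, ρ (b • x) * ρ (b • y) / ‖b • x - b • y‖ =
      (b ^ 3)⁻¹ * ∫ y, ρ (b • x) * ρ y / ‖b • x - y‖ := by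
    intro x
    rw [Measure.integral_comp_smul volume (fun y => ρ (b • x) * ρ y / ‖b • x - y‖) b]
    rw [abs_of_pos (by positivity)]; simp
  simp_rw [h1, integral_const_mul]
  rw [Measure.integral_comp_smul volume (fun x => ∫ y, ρ x * ρ y / ‖x - y‖) b,
    abs_of_pos (by positivity)]
  simp only [finrank_euclideanSpace_fin, smul_eq_mul]
  field_simp

/-- Positivity of the pair energy of a bounded density. -/
lemma Dpair_pos (ρ : R3 → ℝ) (hρ : ∀ x, 0 ≤ ρ x) (hInteg : Integrable ρ)
    (hmass : 0 < ∫ x, ρ x) (B : ℝ) (hB : ∀ x, ρ x ≤ B) : 0 < Dpair ρ := by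
  have hB0 : 0 ≤ B := (hρ 0).trans (hB 0)
  have hptm : ∀ x y : R3, ρ y / ‖x - y‖ ≤ B * kerR 1 (x - y) + ρ y := by
    intro x y
    have h1 := mul_le_mul_of_nonneg_left (ker_le one_pos (x - y)) (hρ y)
    have h2 := mul_le_mul_of_nonneg_right (hB y) (kerR_nonneg 1 (x - y))
    rw [mul_one_div] at h1
    simp only [inv_one] at h1
    linarith
  have hdn : ∀ x y : R3, 0 ≤ ρ y / ‖x - y‖ := fun x y => div_nonneg (hρ y) (norm_nonneg _)
  have hkI : ∀ x : R3, Integrable (fun y => B * kerR 1 (x - y) + ρ y) := fun x =>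
    ((kerR_one_integrable.comp_sub_left x).const_mul B).add hInteg
  have hI : ∀ x : R3, Integrable (fun y => ρ y / ‖x - y‖) := by
    intro x
    refine (hkI x).mono' ?_ (ae_of_all _ fun y => ?_)
    · have hm : Measurable (fun y : R3 => ‖x - y‖) := by fun_prop
      exact (hInteg.aemeasurable.div hm.aemeasurable).aestronglyMeasurable
    · rw [Real.norm_of_nonneg (hdn x y)]; exact hptm x y
  set U : R3 → ℝ := fun x => ∫ y, ρ y / ‖x - y‖ with hU
  have hUle : ∀ x, U x ≤ B * kc + ∫ y, ρ y := by
    intro x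
    calc U x ≤ ∫ y, (B * kerR 1 (x - y) + ρ y) := integral_mono (hI x) (hkI x) (hptm x)
      _ = _ := by
        rw [integral_add ((kerR_one_integrable.comp_sub_left x).const_mul B) hInteg,
          integral_const_mul, integral_sub_left_eq_self (kerR 1) volume x]; rfl
  have hUpos : ∀ x, 0 < U x := by
    intro x
    rw [hU]
    refine lt_of_le_of_ne (integral_nonneg (hdn x)) fun h0 => ?_
    have h1 := (integral_eq_zero_iff_of_nonneg (hdn x) (hI x)).1 h0.symm
    have h2 : ∀ᵐ y : R3, y ≠ x := by
      have : volume ({x} : Set R3) = 0 := measure_singleton x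
      exact compl_mem_ae_iff.2 this
    have h3 : ρ =ᵐ[volume] 0 := by
      filter_upwards [h1, h2] with y hy hyx
      have hne : ‖x - y‖ ≠ 0 := by
        rw [norm_ne_zero_iff, sub_ne_zero]; exact hyx.symm
      simpa [hne] using hy
    rw [integral_congr_ae h3] at hmass
    simp at hmass
  have hUm : AEStronglyMeasurable U volume := by
    have hm : Measurable (fun p : R3 × R3 => ‖p.1 - p.2‖) := by fun_prop
    have h2 : AEMeasurable (fun p : R3 × R3 => ρ p.2) (volume.prod volume) :=
      hInteg.aestronglyMeasurable.comp_snd.aemeasurable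
    exact ((h2.div hm.aemeasurable).aestronglyMeasurable).integral_prod_right'
  have hDI : Integrable (fun x => ρ x * U x) := by
    refine (hInteg.const_mul (B * kc + ∫ y, ρ y)).mono' (hInteg.aestronglyMeasurable.mul hUm)
      (ae_of_all _ fun x => ?_)
    rw [Real.norm_of_nonneg (mul_nonneg (hρ x) (hUpos x).le), mul_comm]
    exact mul_le_mul_of_nonneg_right (hUle x) (hρ x)
  have hD : Dpair ρ = ∫ x, ρ x * U x := by
    unfold Dpair
    simp_rw [mul_div_assoc, integral_const_mul]
    rfl
  have hnn : ∀ x, 0 ≤ ρ x * U x := fun x => mul_nonneg (hρ x) (hUpos x).le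
  rw [hD]
  refine lt_of_le_of_ne (integral_nonneg hnn) fun h0 => ?_
  have h1 := (integral_eq_zero_iff_of_nonneg hnn hDI).1 h0.symm
  have h3 : ρ =ᵐ[volume] 0 := by
    filter_upwards [h1] with y hy
    simpa [(hUpos y).ne'] using hy
  rw [integral_congr_ae h3] at hmass
  simp at hmass

lemma scaling_part (Ψ Ψ' : ℝ → ℝ) (n n' : ℝ) (hΨ : IsPsi Ψ Ψ' n n') (M : ℝ) (hM : 0 < M)
    (ρ : R3 → ℝ) (hρ : MemRM Ψ M ρ) (hBd : ∃ B : ℝ, ∀ x, ρ x ≤ B) :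
      ∃ C > 0, ∃ b₀ > 0, ∀ b : ℝ, 0 < b → b < b₀ →
        MemRM Ψ M (fun x => b ^ 3 * ρ (b • x)) ∧
        Hr Ψ (fun x => b ^ 3 * ρ (b • x)) =
          (b ^ 3)⁻¹ * (∫ x, Ψ (b ^ 3 * ρ x)) + b * Epot ρ ∧
        Hr Ψ (fun x => b ^ 3 * ρ (b • x)) ≤ C * b ^ ((3:ℝ)/n') + b * Epot ρ ∧
        C * b ^ ((3:ℝ)/n') + b * Epot ρ < 0 := by
  obtain ⟨B₀, hB₀⟩ := hBd
  set B := max B₀ 1 with hBdef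
  have hBpos : 0 < B := lt_of_lt_of_le one_pos (le_max_right _ _)
  have hB : ∀ x, ρ x ≤ B := fun x => (hB₀ x).trans (le_max_left _ _)
  have hEneg : Epot ρ < 0 := by
    have := Dpair_pos ρ hρ.nonneg hρ.integrable (by rw [hρ.mass]; exact hM) B hB
    unfold Epot; linarith
  obtain ⟨C, hC, s₂, hs₂, hgs⟩ := hΨ.growth_small
  have hn := hΨ.n'_pos
  have hn3 := hΨ.n'_lt
  have he : 0 < 3 / n' - 1 := by
    rw [sub_pos, one_lt_div hn]; exact hn3
  set C₁ := C * B ^ (1 / n') * M with hC₁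
  have hC₁pos : 0 < C₁ := by positivity
  set q := -Epot ρ / C₁ with hq
  have hqpos : 0 < q := div_pos (by linarith) hC₁pos
  refine ⟨C₁, hC₁pos, min (min 1 (s₂ / B)) (q ^ (1 / (3 / n' - 1))), ?_, ?_⟩
  · have h1 : 0 < q ^ (1 / (3 / n' - 1)) := by positivity
    have h2 : 0 < s₂ / B := by positivity
    exact lt_min (lt_min one_pos h2) h1
  intro b hb hb0
  have hb1 : b < 1 := hb0.trans_le ((min_le_left _ _).trans (min_le_left _ _))
  have hb2 : b < s₂ / B := hb0.trans_le ((min_le_left _ _).trans (min_le_right _ _))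
  have hb3 : b < q ^ (1 / (3 / n' - 1)) := hb0.trans_le (min_le_right _ _)
  have hbc : 0 < b ^ 3 := by positivity
  have hbb : b ^ 3 ≤ b := by nlinarith [mul_pos hb hb]
  have hsmall : ∀ x, b ^ 3 * ρ x ≤ s₂ := by
    intro x
    have h1 : b ^ 3 * ρ x ≤ b * B := mul_le_mul hbb (hB x) (hρ.nonneg x) hb.le
    have h2 : b * B < s₂ := by rwa [lt_div_iff₀ hBpos] at hb2
    linarith
  have hnn : ∀ x, 0 ≤ b ^ 3 * ρ x := fun x => mul_nonneg hbc.le (hρ.nonneg x)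
  have hpow : (b ^ 3) ^ (1 / n') = b ^ ((3:ℝ)/n') := by
    rw [← Real.rpow_natCast, ← Real.rpow_mul hb.le]; congr 1; push_cast; ring
  have hΨle : ∀ x, Ψ (b ^ 3 * ρ x) ≤ (C * B ^ (1 / n') * b ^ ((3:ℝ)/n') * b ^ 3) * ρ x := by
    intro x
    refine (hgs _ (hnn x) (hsmall x)).trans ?_
    have h1 : (b ^ 3 * ρ x) ^ (1 + 1 / n') ≤ (b ^ 3 * ρ x) * (b ^ ((3:ℝ)/n') * B ^ (1 / n')) := by
      rw [Real.rpow_add_of_nonneg (hnn x) (by norm_num) (by positivity), Real.rpow_one]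
      refine mul_le_mul_of_nonneg_left ?_ (hnn x)
      rw [← hpow, ← Real.mul_rpow hbc.le hBpos.le]
      exact Real.rpow_le_rpow (hnn x) (mul_le_mul_of_nonneg_left (hB x) hbc.le) (by positivity)
    calc _ ≤ C * ((b ^ 3 * ρ x) * (b ^ ((3:ℝ)/n') * B ^ (1 / n'))) :=
          mul_le_mul_of_nonneg_left h1 hC.le
      _ = _ := by ring
  have hΨnn : ∀ x, 0 ≤ Ψ (b ^ 3 * ρ x) := fun x => hΨ.nonneg _ (hnn x)
  have hcont : Continuous (fun s : ℝ => Ψ (max s 0)) := by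
    refine continuous_iff_continuousAt.2 fun s => ?_
    have h1 : ContinuousAt Ψ (max s 0) :=
      (hΨ.hasDeriv (max s 0) (mem_Ici.2 (le_max_right _ _))).continuousAt
    exact ContinuousAt.comp (f := fun s : ℝ => max s 0) h1 (by fun_prop)
  have hΨI : Integrable (fun x => Ψ (b ^ 3 * ρ x)) := by
    refine (hρ.integrable.const_mul
      (C * B ^ (1 / n') * b ^ ((3:ℝ)/n') * b ^ 3)).mono' ?_ (ae_of_all _ fun x => ?_)
    · have h1 := hcont.comp_aestronglyMeasurable
        (hρ.integrable.const_mul (b ^ 3)).aestronglyMeasurable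
      refine h1.congr (ae_of_all _ fun x => ?_)
      simp only [max_eq_left (hnn x)]
    · rw [Real.norm_of_nonneg (hΨnn x)]; exact hΨle x
  have hmem : MemRM Ψ M (fun x => b ^ 3 * ρ (b • x)) := by
    refine ⟨fun x => hnn _, ?_, ?_, ?_⟩
    · exact ((integrable_comp_smul_iff volume ρ hb.ne').2 hρ.integrable).const_mul _
    · rw [integral_const_mul, Measure.integral_comp_smul, abs_of_pos (by positivity), hρ.mass]
      simp only [finrank_euclideanSpace_fin, smul_eq_mul]
      field_simp
    · exact (integrable_comp_smul_iff volume (fun x => Ψ (b ^ 3 * ρ x)) hb.ne').2 hΨI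
  have hHr : Hr Ψ (fun x => b ^ 3 * ρ (b • x)) =
      (b ^ 3)⁻¹ * (∫ x, Ψ (b ^ 3 * ρ x)) + b * Epot ρ := by
    unfold Hr Epot
    rw [Dpair_scale ρ b hb,
      Measure.integral_comp_smul volume (fun x => Ψ (b ^ 3 * ρ x)) b, abs_of_pos (by positivity)]
    simp only [finrank_euclideanSpace_fin, smul_eq_mul]
    ring
  refine ⟨hmem, hHr, ?_, ?_⟩
  · rw [hHr]
    have h1 : (∫ x, Ψ (b ^ 3 * ρ x)) ≤ (C * B ^ (1 / n') * b ^ ((3:ℝ)/n') * b ^ 3) * M := by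
      rw [← hρ.mass, ← integral_const_mul]
      exact integral_mono hΨI (hρ.integrable.const_mul _) hΨle
    have h2 := mul_le_mul_of_nonneg_left h1 (inv_nonneg.2 hbc.le)
    have h3 : (b ^ 3)⁻¹ * ((C * B ^ (1 / n') * b ^ ((3:ℝ)/n') * b ^ 3) * M) =
        C₁ * b ^ ((3:ℝ)/n') := by
      rw [hC₁]; field_simp
    linarith
  · have h1 : b ^ (3 / n' - 1) < q := by
      have := Real.rpow_lt_rpow hb.le hb3 he
      rwa [← Real.rpow_mul hqpos.le, one_div_mul_cancel he.ne', Real.rpow_one] at this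
    have h2 : b ^ ((3:ℝ)/n') = b * b ^ (3 / n' - 1) := by
      nth_rewrite 2 [← Real.rpow_one b]
      rw [← Real.rpow_add hb]; congr 1; ring
    rw [hq, lt_div_iff₀ hC₁pos] at h1
    rw [h2]
    nlinarith

lemma exists_bounded (Ψ Ψ' : ℝ → ℝ) (n n' : ℝ) (hΨ : IsPsi Ψ Ψ' n n') (M : ℝ) (hM : 0 < M) :
    ∃ ρ : R3 → ℝ, MemRM Ψ M ρ ∧ ∃ B : ℝ, ∀ x, ρ x ≤ B := by
  set S : Set R3 := Metric.ball 0 1 with hS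
  have hSm : MeasurableSet S := Metric.isOpen_ball.measurableSet
  have hfin : volume S ≠ ⊤ := measure_ball_lt_top.ne
  have hpos : 0 < volume.real S :=
    ENNReal.toReal_pos (Metric.measure_ball_pos volume (0 : R3) one_pos).ne' hfin
  set c := M / volume.real S with hc
  have hc0 : 0 ≤ c := by positivity
  have hInteg : ∀ d : ℝ, Integrable (S.indicator fun _ => d) := fun d =>
    (integrable_indicator_iff hSm).2 (integrableOn_const hfin)
  refine ⟨S.indicator fun _ => c, ⟨fun x => indicator_nonneg (fun _ _ => hc0) x, hInteg c, ?_, ?_⟩,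
    c, fun x => indicator_le_self' (fun _ _ => hc0) x⟩
  · rw [integral_indicator hSm, setIntegral_const, smul_eq_mul, hc]
    field_simp
  · have : (fun x => Ψ (S.indicator (fun _ => c) x)) = S.indicator fun _ => Ψ c := by
      ext x
      by_cases hx : x ∈ S <;> simp [hx, hΨ.zero]
    rw [this]; exact hInteg _

/-- `h_M = inf_{R_M} H_r < 0`; more precisely, for any bounded,
compactly supported, nonzero `ρ ∈ R_M` and the rescalings `ρ̄_b(x) = b³ρ(bx)`,
one has `H_r(ρ̄_b) = b⁻³∫Ψ(b³ρ) + b E_pot(ρ) ≤ C b^{3/n'} + b E_pot(ρ) < 0`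
for all sufficiently small `b > 0`. -/
theorem reduced_infimum_negative
    (Ψ Ψ' : ℝ → ℝ) (n n' : ℝ) (hΨ : IsPsi Ψ Ψ' n n') (M : ℝ) (hM : 0 < M) :
    sInf (Hr Ψ '' RMset Ψ M) < 0 ∧
    ∀ ρ : R3 → ℝ, MemRM Ψ M ρ → (∃ B : ℝ, ∀ x, ρ x ≤ B) → HasCompactSupport ρ →
      ρ ≠ 0 →
      ∃ C > 0, ∃ b₀ > 0, ∀ b : ℝ, 0 < b → b < b₀ →
        MemRM Ψ M (fun x => b ^ 3 * ρ (b • x)) ∧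
        Hr Ψ (fun x => b ^ 3 * ρ (b • x)) =
          (b ^ 3)⁻¹ * (∫ x, Ψ (b ^ 3 * ρ x)) + b * Epot ρ ∧
        Hr Ψ (fun x => b ^ 3 * ρ (b • x)) ≤ C * b ^ ((3:ℝ)/n') + b * Epot ρ ∧
        C * b ^ ((3:ℝ)/n') + b * Epot ρ < 0 := by
  have hmain := scaling_part Ψ Ψ' n n' hΨ M hM
  refine ⟨?_, fun ρ hρ hB _ _ => hmain ρ hρ hB⟩
  obtain ⟨ρ, hρ, hB⟩ := exists_bounded Ψ Ψ' n n' hΨ M hM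
  obtain ⟨C, _, b₀, hb₀, h⟩ := hmain ρ hρ hB
  obtain ⟨h1, _, h3, h4⟩ := h (b₀ / 2) (by linarith) (by linarith)
  exact (csInf_le (Hr_bddBelow Ψ Ψ' n n' hΨ M hM) ⟨_, h1, rfl⟩).trans_lt (h3.trans_lt h4)
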